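/- Let A be an HWGT over Σ = 2^AP, Q_i a non-transient component of A and q ∈ Q_i. If Q_i is existential, then the linearized word automaton A_{Q_i,q} recognizes a co-safety language, i.e., L(A_{Q_i,q}) = W·Γ^ω for some set W of finite words over the alphabet Γ = Σ × 2^B; if Q_i is universal, then A_{Q_i,q} recognizes a safety language, i.e., the complement of L(A_{Q_i,q}) in Γ^ω is of the form W·Γ^ω for some set W of finite words over Γ. -/

import Mathlib

set_option maxHeartbeats 1000000

namespace FOTrees

/-- An unranked, unordered, finitely-branching infinite tree:
a connected acyclic graph with a total (every node has a successor),
finitely-branching transition relation, rooted at `root`. -/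
structure Tree (V : Type) where
  root : V
  edge : V → V → Prop
  total : ∀ v, ∃ w, edge v w
  finBranch : ∀ v, {w | edge v w}.Finite
  rootNoParent : ∀ v, ¬ edge v root
  parentUnique : ∀ ⦃u v w : V⦄, edge u w → edge v w → u = v
  reach : ∀ v, Relation.ReflTransGen edge root v
  acyclic : ∀ v, ¬ Relation.TransGen edge v v

/-- A finite (non-empty) path of a tree: it starts at the root and each
element after the first is a child of its predecessor. -/
def IsFinPath {V : Type} (t : Tree V) (π : List V) : Prop :=
  π ≠ [] ∧ π.head? = some t.root ∧
    ∀ (i : ℕ) (h : i + 1 < π.length),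
      t.edge (π[i]'(Nat.lt_of_succ_lt h)) (π[i + 1]'h)

/-- An infinite path of a tree. -/
def IsInfPath {V : Type} (t : Tree V) (π : ℕ → V) : Prop :=
  π 0 = t.root ∧ ∀ i, t.edge (π i) (π (i + 1))

/-- A Σ-labelled tree (Σ = 2^AP), bundled together with its type of vertices. -/
structure STree (AP : Type) where
  V : Type
  t : Tree V
  τ : V → Set AP

end FOTrees
namespace FOTrees

/-- Positive Boolean formulas over a set `X` of atoms. -/
inductive PosBool (X : Type) : Type where
  | tru  : PosBool X
  | fls  : PosBool X
  | var  : X → PosBool X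
  | por  : PosBool X → PosBool X → PosBool X
  | pand : PosBool X → PosBool X → PosBool X

/-- Satisfaction of a positive Boolean formula under an assignment. -/
def PosBool.Holds {X : Type} (S : X → Prop) : PosBool X → Prop
  | .tru => True
  | .fls => False
  | .var a => S a
  | .por θ₁ θ₂ => PosBool.Holds S θ₁ ∨ PosBool.Holds S θ₂
  | .pand θ₁ θ₂ => PosBool.Holds S θ₁ ∧ PosBool.Holds S θ₂

/-- The set of atoms occurring in a positive Boolean formula. -/
def PosBool.atoms {X : Type} : PosBool X → Set X
  | .tru => ∅
  | .fls => ∅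
  | .var a => {a}
  | .por θ₁ θ₂ => PosBool.atoms θ₁ ∪ PosBool.atoms θ₂
  | .pand θ₁ θ₂ => PosBool.atoms θ₁ ∪ PosBool.atoms θ₂

/-- Renaming of atoms. -/
def PosBool.map {X Y : Type} (f : X → Y) : PosBool X → PosBool Y
  | .tru => .tru
  | .fls => .fls
  | .var a => .var (f a)
  | .por θ₁ θ₂ => .por (PosBool.map f θ₁) (PosBool.map f θ₂)
  | .pand θ₁ θ₂ => .pand (PosBool.map f θ₁) (PosBool.map f θ₂)

/-- The disjunctive normal form, as a list of clauses (lists of atoms). -/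
def PosBool.dnf {X : Type} : PosBool X → List (List X)
  | .tru => [[]]
  | .fls => []
  | .var a => [[a]]
  | .por θ₁ θ₂ => PosBool.dnf θ₁ ++ PosBool.dnf θ₂
  | .pand θ₁ θ₂ =>
      (PosBool.dnf θ₁).flatMap fun c₁ => (PosBool.dnf θ₂).map fun c₂ => c₁ ++ c₂

/-- The conjunctive normal form, as a list of clauses (lists of atoms). -/
def PosBool.cnf {X : Type} : PosBool X → List (List X)
  | .tru => []
  | .fls => [[]]
  | .var a => [[a]]
  | .pand θ₁ θ₂ => PosBool.cnf θ₁ ++ PosBool.cnf θ₂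
  | .por θ₁ θ₂ =>
      (PosBool.cnf θ₁).flatMap fun c₁ => (PosBool.cnf θ₂).map fun c₂ => c₁ ++ c₂

/-- Disjunction of a list of atoms. -/
def PosBool.bigOrList {X : Type} : List X → PosBool X
  | [] => .fls
  | a :: l => .por (.var a) (PosBool.bigOrList l)

/-- Disjunction `⋁ C` of a finite set of atoms. -/
noncomputable def PosBool.bigOr {X : Type} (C : Finset X) : PosBool X :=
  PosBool.bigOrList C.toList

/-- A raw (run) tree: a connected acyclic rooted graph, possibly with leaves
and with no branching restrictions. -/
structure RawTree (W : Type) where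
  root : W
  edge : W → W → Prop
  rootNoParent : ∀ v, ¬ edge v root
  parentUnique : ∀ ⦃u v w : W⦄, edge u w → edge v w → u = v
  reach : ∀ v, Relation.ReflTransGen edge root v
  acyclic : ∀ v, ¬ Relation.TransGen edge v v

/-- The state `q` is visited infinitely often along `f`. -/
def InfinitelyOftenState {W Q : Type} (stq : W → Q) (f : ℕ → W) (q : Q) : Prop :=
  ∀ N, ∃ n, N ≤ n ∧ stq (f n) = q

/-- A run (tree) is successful iff every maximal path in it either ends in a
leaf, or is infinite and the highest priority of the states visited infinitely
often along it is even. -/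
def SuccessfulRun {W Q : Type} (R : RawTree W) (stq : W → Q) (Ω : Q → ℕ) : Prop :=
  ∀ f : ℕ → W, f 0 = R.root → (∀ i, R.edge (f i) (f (i + 1))) →
    ∃ q, InfinitelyOftenState stq f q ∧ Even (Ω q) ∧
      ∀ q', InfinitelyOftenState stq f q' → Ω q' ≤ Ω q

end FOTrees
namespace FOTrees

/-- Graded atoms `(◇_k, q)` and `(□_k, q)`, with `k > 0`. -/
inductive GAtom (Q : Type) : Type where
  | dia : ℕ+ → Q → GAtom Q
  | box : ℕ+ → Q → GAtom Q

/-- The state occurring in a graded atom. -/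
def GAtom.state {Q : Type} : GAtom Q → Q
  | .dia _ q => q
  | .box _ q => q

/-- Renaming of states in a graded atom. -/
def GAtom.map {Q Q' : Type} (f : Q → Q') : GAtom Q → GAtom Q'
  | .dia k q => .dia k (f q)
  | .box k q => .box k (f q)

/-- A Graded Alternating (Parity) Tree Automaton. -/
structure GTA (Q AP : Type) where
  δ : Q → Set AP → PosBool (GAtom Q)
  init : Q
  Ω : Q → ℕ

/-- Satisfaction of a graded atom at a node `s` of a candidate run `(R, ρ)`
on an input tree `t`:
`(◇_k, q')` holds iff the input node has at least `k` distinct successors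
each of which labels (with `q'`) some child of `s`; `(□_k, q')` holds iff all
but at most `k - 1` successors of the input node label (with `q'`) some child
of `s`. -/
def GAtom.HoldsAt {V W Q : Type} (t : Tree V) (R : RawTree W)
    (ρ : W → V × Q) (s : W) : GAtom Q → Prop
  | .dia k q' => ∃ g : Fin (k : ℕ) → V, Function.Injective g ∧
      ∀ j, t.edge (ρ s).1 (g j) ∧ ∃ s', R.edge s s' ∧ ρ s' = (g j, q')
  | .box k q' => ∃ F : Finset V, F.card ≤ (k : ℕ) - 1 ∧
      ∀ n', t.edge (ρ s).1 n' → n' ∉ F → ∃ s', R.edge s s' ∧ ρ s' = (n', q')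

/-- The automaton `A` accepts the tree `t` starting at the node `v₀`: there is
a successful run, i.e. a `(V × Q)`-labelled tree whose root is labelled
`(v₀, q_I)`, in which every node satisfies the corresponding transition
condition, and all whose maximal paths are accepting. -/
def GTA.AcceptsFrom {Q AP : Type} (A : GTA Q AP) {V : Type} (t : Tree V)
    (τ : V → Set AP) (v₀ : V) : Prop :=
  ∃ (W : Type) (R : RawTree W) (ρ : W → V × Q),
    ρ R.root = (v₀, A.init) ∧
    (∀ s, PosBool.Holds (fun a => GAtom.HoldsAt t R ρ s a)
      (A.δ (ρ s).2 (τ (ρ s).1))) ∧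
    SuccessfulRun R (fun w => (ρ w).2) A.Ω

/-- Acceptance of a Σ-tree (from its root). -/
def GTA.Accepts {Q AP : Type} (A : GTA Q AP) (T : STree AP) : Prop :=
  A.AcceptsFrom T.t T.τ T.t.root

/-- The automaton `A^θ`: `A` with a fresh initial state `q_θ` (here `none`)
whose transition is `θ` on every letter. -/
def GTA.extend {Q AP : Type} (A : GTA Q AP) (θ : PosBool (GAtom Q)) :
    GTA (Option Q) AP where
  init := none
  δ := fun s σ => match s with
    | none => θ.map (GAtom.map some)
    | some q => (A.δ q σ).map (GAtom.map some)
  Ω := fun s => s.elim 1 A.Ω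

/-- Types of components of a hesitant automaton. -/
inductive CompType : Type where
  | transient | existential | universal

/-- No atom of `θ` carries a state in the component `c`. -/
def NoCompAtoms {Q : Type} (c : Q → Prop) (θ : PosBool (GAtom Q)) : Prop :=
  ∀ a ∈ θ.atoms, ¬ c a.state

/-- Hesitant condition for existential components: states of the component
occur only in atoms `(◇, q')` (i.e. `◇_1`), and only disjunctively related to
other atoms carrying states of the component. -/
def ExOK {Q : Type} (c : Q → Prop) : PosBool (GAtom Q) → Prop
  | .tru => True
  | .fls => True
  | .var a => (∃ q', a = .dia 1 q' ∧ c q') ∨ ¬ c a.state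
  | .por θ₁ θ₂ => ExOK c θ₁ ∧ ExOK c θ₂
  | .pand θ₁ θ₂ => (ExOK c θ₁ ∧ NoCompAtoms c θ₂) ∨ (NoCompAtoms c θ₁ ∧ ExOK c θ₂)

/-- Hesitant condition for universal components: states of the component occur
only in atoms `(□, q')` (i.e. `□_1`), and only conjunctively related to other
atoms carrying states of the component. -/
def UnivOK {Q : Type} (c : Q → Prop) : PosBool (GAtom Q) → Prop
  | .tru => True
  | .fls => True
  | .var a => (∃ q', a = .box 1 q' ∧ c q') ∨ ¬ c a.state
  | .pand θ₁ θ₂ => UnivOK c θ₁ ∧ UnivOK c θ₂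
  | .por θ₁ θ₂ => (UnivOK c θ₁ ∧ NoCompAtoms c θ₂) ∨ (NoCompAtoms c θ₁ ∧ UnivOK c θ₂)

/-- A Hesitant Weak Graded Alternating Tree Automaton (HWGT): the states are
partitioned into components (here indexed by naturals, `part q` being the
component of `q`), transitions go to the same or lower components, every
component is transient, existential or universal, states of existential
components have odd priority and states of universal components have even
priority. -/
structure HWGT (Q AP : Type) extends GTA Q AP where
  part : Q → ℕ
  ctype : ℕ → CompType
  mono : ∀ q σ, ∀ a ∈ (δ q σ).atoms, part a.state ≤ part q
  transientOK : ∀ q σ, ctype (part q) = .transient →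
    ∀ a ∈ (δ q σ).atoms, part a.state ≠ part q
  existOK : ∀ q σ, ctype (part q) = .existential →
    ExOK (fun q' => part q' = part q) (δ q σ)
  univOK : ∀ q σ, ctype (part q) = .universal →
    UnivOK (fun q' => part q' = part q) (δ q σ)
  parityEx : ∀ q, ctype (part q) = .existential → Odd (Ω q)
  parityUniv : ∀ q, ctype (part q) = .universal → Even (Ω q)

/-- Acceptance for an HWGT. -/
def HWGT.Accepts {Q AP : Type} (A : HWGT Q AP) (T : STree AP) : Prop :=
  A.toGTA.Accepts T

/-- The automaton `A^q`: `A` with initial state `q`. -/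
def HWGT.withInit {Q AP : Type} (A : HWGT Q AP) (q : Q) : HWGT Q AP :=
  { A with init := q }

/-- An HWGT is linear (an HLGT) iff its components are all singletons. -/
def HWGT.Linear {Q AP : Type} (A : HWGT Q AP) : Prop :=
  Function.Injective A.part

end FOTrees
namespace FOTrees

/-- A (nondeterministic or universal) word automaton over the alphabet `Γ`. -/
structure WordAuto (S Γ : Type) where
  init : S
  δ : S → Γ → Set S

/-- A run of a word automaton on an infinite word. -/
def WordAuto.IsRun {S Γ : Type} (A : WordAuto S Γ) (ξ : ℕ → Γ) (r : ℕ → S) :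
    Prop :=
  r 0 = A.init ∧ ∀ i, r (i + 1) ∈ A.δ (r i) (ξ i)

/-- The run visits the set `F` infinitely often. -/
def InfOft {S : Type} (r : ℕ → S) (F : Set S) : Prop :=
  ∀ N, ∃ n, N ≤ n ∧ r n ∈ F

/-- The language of a nondeterministic coBüchi automaton with rejecting set
`F`: some run visits `F` only finitely often. -/
def WordAuto.NCALang {S Γ : Type} (A : WordAuto S Γ) (F : Set S) :
    Set (ℕ → Γ) :=
  {ξ | ∃ r, A.IsRun ξ r ∧ ¬ InfOft r F}

/-- The language of a universal Büchi automaton with accepting set `F`: every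
run visits `F` infinitely often. -/
def WordAuto.UBALang {S Γ : Type} (A : WordAuto S Γ) (F : Set S) :
    Set (ℕ → Γ) :=
  {ξ | ∀ r, A.IsRun ξ r → InfOft r F}

/-- A path of a word automaton on a finite word, from a state to a state. -/
def WordAuto.Path {S Γ : Type} (A : WordAuto S Γ) : S → List Γ → S → Prop
  | s, [], s'' => s = s''
  | s, a :: w, s'' => ∃ s', s' ∈ A.δ s a ∧ A.Path s' w s''

/-- The `n`-th power `ι^n` of a finite word `ι`. -/
def wordPow {Γ : Type} (ι : List Γ) : ℕ → List Γ
  | 0 => []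
  | n + 1 => ι ++ wordPow ι n

/-- A word automaton is counter-free iff whenever it admits a path on `ι^n`
(`n ≥ 1`) from a state `q` back to `q`, it admits a path on `ι` from `q` back
to `q`. -/
def WordAuto.CounterFree {S Γ : Type} (A : WordAuto S Γ) : Prop :=
  ∀ (q : S) (ι : List Γ) (n : ℕ), 1 ≤ n →
    A.Path q (wordPow ι n) q → A.Path q ι q

/-- A word automaton with acceptance set `F` is looping iff all states are
accepting (resp. rejecting) except a single sink state. -/
def WordAuto.Looping {S Γ : Type} (A : WordAuto S Γ) (F : Set S) : Prop :=
  ∃ s₀ : S, F = {s | s ≠ s₀} ∧ ∀ γ, A.δ s₀ γ = {s₀}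

/-- The finite word formed by the first `k` letters of the infinite word `ξ`. -/
def prefixWord {Γ : Type} (ξ : ℕ → Γ) (k : ℕ) : List Γ :=
  (List.range k).map ξ

end FOTrees
namespace FOTrees

/-- The alphabet `Σ × 2^B` of the linearized word automata. -/
abbrev LinAlpha (Q AP : Type) : Type := Set AP × Finset (GAtom Q)

/-- Transition relation of the linearization of an existential component `i`:
over states `Option Q` (`none` being the fresh exit state), on the letter
`(σ, C)` the automaton moves from `q'` to a component state `q''` iff the DNF
of `δ(q', σ)` contains a clause `(◇, q'') ∧ ⋀C`, and exits iff the DNF of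
`δ(q', σ)` contains a clause `⋀C`; the exit state loops. -/
def HWGT.linDeltaEx {Q AP : Type} (A : HWGT Q AP) (i : ℕ)
    (s : Option Q) (γ : LinAlpha Q AP) : Set (Option Q) :=
  {s' | match s, s' with
    | none, none => True
    | none, some _ => False
    | some q', none =>
        A.part q' = i ∧
          ∃ c ∈ (A.δ q' γ.1).dnf, {a | a ∈ c} = (↑γ.2 : Set (GAtom Q))
    | some q', some q'' =>
        A.part q' = i ∧ A.part q'' = i ∧
          ∃ c ∈ (A.δ q' γ.1).dnf,
            {a | a ∈ c} = insert (GAtom.dia 1 q'') (↑γ.2 : Set (GAtom Q))}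

/-- Transition relation of the linearization of a universal component `i`:
defined dually, via the CNF of `δ(q', σ)` and clauses `(□, q'') ∨ ⋁C` and
`⋁C`. -/
def HWGT.linDeltaUniv {Q AP : Type} (A : HWGT Q AP) (i : ℕ)
    (s : Option Q) (γ : LinAlpha Q AP) : Set (Option Q) :=
  {s' | match s, s' with
    | none, none => True
    | none, some _ => False
    | some q', none =>
        A.part q' = i ∧
          ∃ c ∈ (A.δ q' γ.1).cnf, {a | a ∈ c} = (↑γ.2 : Set (GAtom Q))
    | some q', some q'' =>
        A.part q' = i ∧ A.part q'' = i ∧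
          ∃ c ∈ (A.δ q' γ.1).cnf,
            {a | a ∈ c} = insert (GAtom.box 1 q'') (↑γ.2 : Set (GAtom Q))}

/-- Transition relation of the linearization of the component `i`. -/
def HWGT.linDelta {Q AP : Type} (A : HWGT Q AP) (i : ℕ) :
    Option Q → LinAlpha Q AP → Set (Option Q) :=
  match A.ctype i with
  | .existential => A.linDeltaEx i
  | .universal => A.linDeltaUniv i
  | .transient => fun _ _ => ∅

/-- The linearized word automaton `A_{Q_i, q}` of the component `i` of an
HWGT, with initial state `q`. -/
def HWGT.linAuto {Q AP : Type} (A : HWGT Q AP) (i : ℕ) (q : Q) :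
    WordAuto (Option Q) (LinAlpha Q AP) :=
  ⟨some q, A.linDelta i⟩

/-- The states of the linearized automaton belonging to the component `i`. -/
def HWGT.compStates {Q AP : Type} (A : HWGT Q AP) (i : ℕ) : Set (Option Q) :=
  {s | ∃ q', s = some q' ∧ A.part q' = i}

/-- The language of the linearized word automaton `A_{Q_i, q}`: a
nondeterministic coBüchi automaton with rejecting set `Q_i` if the component
is existential, a universal Büchi automaton with accepting set `Q_i` if the
component is universal. -/
def HWGT.linLang {Q AP : Type} (A : HWGT Q AP) (i : ℕ) (q : Q) :
    Set (ℕ → LinAlpha Q AP) :=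
  match A.ctype i with
  | .existential => (A.linAuto i q).NCALang (A.compStates i)
  | .universal => (A.linAuto i q).UBALang (A.compStates i)
  | .transient => ∅

/-- `B_{Q_i}`: the set of letter annotations `C` on which the linearized
automaton of the component `i` has a transition staying in the component. -/
def HWGT.BQ {Q AP : Type} (A : HWGT Q AP) (i : ℕ) : Set (Finset (GAtom Q)) :=
  {C | ∃ q' σ q'', A.part q' = i ∧ A.part q'' = i ∧
    some q'' ∈ A.linDelta i (some q') (σ, C)}

/-- A non-empty, non-transient component. -/
def HWGT.NonTransient {Q AP : Type} (A : HWGT Q AP) (i : ℕ) : Prop :=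
  (∃ q, A.part q = i) ∧ A.ctype i ≠ CompType.transient

/-- The mutual exclusion property: for every non-transient component `Q_i` and
all distinct `C, C' ∈ B_{Q_i}` there are atoms `α ∈ C` and `β ∈ C'` such that
`L(A^α)` is the complement of `L(A^β)`. -/
def HWGT.Mutex {Q AP : Type} (A : HWGT Q AP) : Prop :=
  ∀ i, A.NonTransient i → ∀ C C', C ∈ A.BQ i → C' ∈ A.BQ i → C ≠ C' →
    ∃ α ∈ C, ∃ β ∈ C', ∀ T : STree AP,
      (A.toGTA.extend (.var α)).Accepts T ↔ ¬ (A.toGTA.extend (.var β)).Accepts T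

/-- The class HWGT_cf: HWGTs satisfying mutual exclusion, all of whose
linearized word automata (of non-transient components) are counter-free. -/
def HWGT.IsCF {Q AP : Type} (A : HWGT Q AP) : Prop :=
  A.Mutex ∧
    ∀ i, A.NonTransient i → ∀ q, A.part q = i → (A.linAuto i q).CounterFree

end FOTrees
namespace FOTrees

/-- In an automaton over `Option S` whose state `none` has a self-loop on every letter and
all of whose other reachable states lie in `F`, some run eventually avoids `F` iff some finite
prefix of the word leads to `none`. -/
theorem WordAuto.exists_run_not_infOft_iff {S Γ : Type} (A : WordAuto (Option S) Γ)
    (F : Set (Option S)) (h_none : none ∉ F) (h_init : A.init ∈ F)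
    (h_loop : ∀ γ, none ∈ A.δ none γ)
    (h_step : ∀ s γ s', some s' ∈ A.δ s γ → some s' ∈ F) (ξ : ℕ → Γ) :
    (∃ r, A.IsRun ξ r ∧ ¬ InfOft r F) ↔
      ∃ k, prefixWord ξ k ∈ {w : List Γ | ∃ r : ℕ → Option S, r 0 = A.init ∧
        (∀ j (h : j < w.length), r (j + 1) ∈ A.δ (r j) w[j]) ∧ r w.length = none} := by
  simp only [Set.mem_ofPred_eq, prefixWord, List.length_map, List.length_range,
    List.getElem_map, List.getElem_range]
  constructor
  · rintro ⟨r, ⟨h0, hr⟩, hF⟩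
    simp only [InfOft, not_forall, not_exists, not_and] at hF
    obtain ⟨N, hN⟩ := hF
    refine ⟨N, r, h0, fun j _ => hr j, ?_⟩
    have hmem : ∀ m, r m = none ∨ r m ∈ F := by
      intro m
      cases m with
      | zero => exact .inr (h0 ▸ h_init)
      | succ m =>
        have hm := hr m
        cases hs : r (m + 1) with
        | none => exact .inl rfl
        | some s => exact .inr (h_step _ _ _ (hs ▸ hm))
    exact (hmem N).resolve_right (hN N le_rfl)
  · rintro ⟨k, r, h0, hr, hk⟩
    refine ⟨fun m => if m ≤ k then r m else none, ⟨by simpa using h0, fun j => ?_⟩, fun hinf => ?_⟩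
    · rcases lt_trichotomy j k with h | rfl | h
      · simpa [h.le, Nat.succ_le_of_lt h] using hr j h
      · simpa [hk] using h_loop (ξ j)
      · simpa [h.not_ge, (h.trans (Nat.lt_succ_self j)).not_ge] using h_loop (ξ j)
    · obtain ⟨m, hm, hmF⟩ := hinf (k + 1)
      beta_reduce at hmF
      rw [if_neg (by omega)] at hmF
      exact h_none hmF

end FOTrees

open FOTrees in
/-- Linearizations of components of an HWGT recognize (co-)safety languages:
if `Q_i` is existential then `L(A_{Q_i,q}) = W·Γ^ω` for some set `W` of finite
words; if `Q_i` is universal then the complement of `L(A_{Q_i,q})` is of the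
form `W·Γ^ω`. -/
theorem stmt13 (AP : Type) [Fintype AP] (n : ℕ) (A : HWGT (Fin n) AP)
    (i : ℕ) (q : Fin n) (hq : A.part q = i) :
    (A.ctype i = CompType.existential →
      ∃ W : Set (List (LinAlpha (Fin n) AP)),
        A.linLang i q = {ξ | ∃ k, prefixWord ξ k ∈ W}) ∧
    (A.ctype i = CompType.universal →
      ∃ W : Set (List (LinAlpha (Fin n) AP)),
        {ξ | ξ ∉ A.linLang i q} = {ξ | ∃ k, prefixWord ξ k ∈ W}) := by
  have h_none : none ∉ A.compStates i := by simp [HWGT.compStates]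
  have h_init : (A.linAuto i q).init ∈ A.compStates i := ⟨q, rfl, hq⟩
  constructor
  all_goals
    intro hc
    have key := (A.linAuto i q).exists_run_not_infOft_iff (A.compStates i) h_none h_init
      (by intro γ; simp [HWGT.linAuto, HWGT.linDelta, hc, HWGT.linDeltaEx, HWGT.linDeltaUniv])
      (by
        rintro (_ | s) γ s' h <;>
          simp [HWGT.linAuto, HWGT.linDelta, hc, HWGT.linDeltaEx, HWGT.linDeltaUniv] at h
        exact ⟨s', rfl, h.2.1⟩)
    refine ⟨_, Set.ext fun ξ => Iff.trans ?_ (key ξ)⟩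
    simp [HWGT.linLang, hc, WordAuto.NCALang, WordAuto.UBALang]
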